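/- arXiv:1510.05597 — 2 statements merged into one kernel-verified Lean document; each statement's English description precedes it below -/
import Mathlib

section
/- Let R be a complete Noetherian local domain containing a field, with maximal ideal m. Then there exists a coefficient field, i.e. a subfield F ⊆ R such that the composite F → R → R/m is an isomorphism of fields. -/
/-- If `c : k` becomes a `p`-th power of `r` in the `k`-algebra `S` and `φ r ∉ k`, then the
`k`-algebra map `φ` to a field of characteristic `p` is injective on `k[r]`. -/
theorem eq_zero_of_mem_adjoin_singleton_of_pow_eq {k S K : Type*} [Field k] [CommRing S] [Field K]
    [Algebra k S] [Algebra k K] (φ : S →ₐ[k] K) (p : ℕ) [Fact p.Prime] [CharP k p]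
    {r : S} {c : k} (hc : r ^ p = algebraMap k S c) (hr : φ r ∉ (algebraMap k K).range)
    {x : S} (hx : x ∈ Algebra.adjoin k {r}) (hφ : φ x = 0) : x = 0 := by
  have : CharP K p := charP_of_injective_algebraMap (algebraMap k K).injective p
  have hirr : Irreducible (Polynomial.X ^ p - Polynomial.C c) := by
    refine X_pow_sub_C_irreducible_of_prime Fact.out fun b hb ↦ hr ⟨b, ?_⟩
    apply frobenius_inj K p
    simp only [frobenius_def]
    rw [← map_pow, hb, ← map_pow, hc, φ.commutes]
  obtain ⟨q, rfl⟩ := Algebra.adjoin_singleton_eq_range_aeval k r ▸ hx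
  replace hφ : Polynomial.aeval (φ r) q = 0 := by
    rw [Polynomial.aeval_algHom_apply]; exact hφ
  have hmin := minpoly.eq_of_irreducible_of_monic hirr (x := φ r)
    (by simp [← map_pow φ, hc]) (Polynomial.monic_X_pow_sub_C c (Fact.out : p.Prime).ne_zero)
  obtain ⟨h, rfl⟩ := hmin ▸ minpoly.dvd k (φ r) hφ
  simp [hc]

/-- A surjection with square-zero kernel from a ring of prime characteristic onto a field has a
section. Its image is a maximal subring which contains all `p`-th powers and is disjoint from the
kernel outside `0`. -/
theorem exists_ringHom_section_of_charP {S K : Type*} [CommRing S] [Field K] (p : ℕ)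
    [Fact p.Prime] [CharP S p] (φ : S →+* K) (hφ : Function.Surjective φ)
    (hker : RingHom.ker φ ^ 2 = ⊥) : ∃ g : K →+* S, φ.comp g = RingHom.id K := by
  have hpow {x : S} {n : ℕ} (hn : 2 ≤ n) (hx : φ x = 0) : x ^ n = 0 := by
    have : x ^ 2 ∈ RingHom.ker φ ^ 2 := Ideal.pow_mem_pow hx 2
    exact pow_eq_zero_of_le hn (by simpa [hker] using this)
  have hunit {x : S} (hx : φ x ≠ 0) : IsUnit x := by
    obtain ⟨y, hy⟩ := hφ (φ x)⁻¹
    have : (x * y - 1) ^ 2 = 0 := hpow le_rfl (by simp [hy, hx])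
    exact .of_mul_eq_one (y * (2 - x * y)) (by linear_combination -this)
  have hp : 2 ≤ p := (Fact.out : p.Prime).two_le
  obtain ⟨T, -, ⟨hfrob, hinj⟩, hmax⟩ := zorn_le_nonempty₀
    {T : Subring S | (frobenius S p).range ≤ T ∧ ∀ x ∈ T, φ x = 0 → x = 0}
    (fun c hc hchain T hT ↦ by
      have hmem {x : S} := Subring.mem_sSup_of_directedOn (x := x) ⟨T, hT⟩ hchain.directedOn
      refine ⟨sSup c, ⟨(hc hT).1.trans (le_sSup hT), fun x hx h ↦ ?_⟩, fun _ ↦ le_sSup⟩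
      obtain ⟨U, hU, hxU⟩ := hmem.1 hx
      exact (hc hU).2 x hxU h)
    (frobenius S p).range
    ⟨le_rfl, by
      rintro _ ⟨y, rfl⟩ h
      rw [frobenius_def, map_pow] at h
      exact hpow hp (pow_eq_zero_iff (by omega) |>.1 h)⟩
  have : Nontrivial S := φ.domain_nontrivial
  have hfield : IsField T := by
    refine ⟨⟨0, 1, zero_ne_one⟩, mul_comm, fun {a} ha ↦ ?_⟩
    obtain ⟨b, hb⟩ := (hunit fun h ↦ ha (Subtype.ext (hinj a a.2 h))).exists_right_inv
    refine ⟨a ^ (p - 1) * ⟨b ^ p, hfrob ⟨b, rfl⟩⟩, Subtype.ext ?_⟩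
    change (a : S) * (a ^ (p - 1) * b ^ p) = 1
    rw [← mul_assoc, mul_pow_sub_one (by omega), ← mul_pow, hb, one_pow]
  have hsurj : Function.Surjective (φ.comp T.subtype) := by
    intro a
    obtain ⟨r, rfl⟩ := hφ a
    by_contra hr
    let : Field T := hfield.toField
    let : Algebra T K := (φ.comp T.subtype).toAlgebra
    have : CharP T p := (RingHom.charP_iff T.subtype Subtype.val_injective p).2 inferInstance
    let ψ : S →ₐ[T] K := ⟨φ, fun _ ↦ rfl⟩
    have hT : T ≤ (Algebra.adjoin T {r}).toSubring := fun x hx ↦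
      (Algebra.adjoin T {r}).algebraMap_mem ⟨x, hx⟩
    refine hr ⟨⟨r, hmax ⟨hfrob.trans hT, fun x hx h ↦ ?_⟩ hT
      (Algebra.self_mem_adjoin_singleton T r)⟩, rfl⟩
    exact eq_zero_of_mem_adjoin_singleton_of_pow_eq ψ p (c := ⟨r ^ p, hfrob ⟨r, rfl⟩⟩) rfl hr hx h
  have hbij : Function.Bijective (φ.comp T.subtype) :=
    ⟨(injective_iff_map_eq_zero _).2 fun x hx ↦ Subtype.ext (hinj x x.2 hx), hsurj⟩
  let e := RingEquiv.ofBijective _ hbij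
  exact ⟨T.subtype.comp e.symm, RingHom.ext e.apply_symm_apply⟩

/-- Every field extension of `ZMod p` is formally smooth. -/
theorem formallySmooth_zmod (p : ℕ) [Fact p.Prime] (K : Type*) [Field K] [Algebra (ZMod p) K] :
    Algebra.FormallySmooth (ZMod p) K := by
  let f : MvPolynomial K (ZMod p) →ₐ[ZMod p] K := MvPolynomial.aeval id
  have hf : Function.Surjective f.kerSquareLift := fun x ↦
    ⟨Ideal.Quotient.mk _ (.X x), MvPolynomial.aeval_X (R := ZMod p) id x⟩
  have : Nontrivial (MvPolynomial K (ZMod p) ⧸ RingHom.ker f.toRingHom ^ 2) :=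
    f.kerSquareLift.toRingHom.domain_nontrivial
  have : CharP (MvPolynomial K (ZMod p) ⧸ RingHom.ker f.toRingHom ^ 2) p :=
    charP_of_injective_algebraMap (algebraMap (ZMod p) _).injective p
  obtain ⟨g, hg⟩ := exists_ringHom_section_of_charP p f.kerSquareLift.toRingHom hf (by
    rw [AlgHom.ker_kerSquareLift]
    exact Ideal.cotangentIdeal_square _)
  let g' : K →ₐ[ZMod p] MvPolynomial K (ZMod p) ⧸ RingHom.ker f.toRingHom ^ 2 :=
    ⟨g, RingHom.congr_fun (Subsingleton.elim (g.comp (algebraMap (ZMod p) K)) _)⟩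
  exact .of_split f g' (AlgHom.ext fun x ↦ congr($hg x))

/-- Every field extension in characteristic zero is formally smooth. -/
theorem formallySmooth_of_charZero (k K : Type*) [Field k] [CharZero k] [Field K] [Algebra k K] :
    Algebra.FormallySmooth k K := by
  obtain ⟨s, hs⟩ := exists_isTranscendenceBasis k K
  have := hs.isAlgebraic_field
  exact .of_algebraicIndependent_of_isSeparable hs.1

open IsLocalRing in
/-- A complete local `k`-algebra has a coefficient field if its residue field is formally smooth
over `k`. -/
theorem exists_coefficient_field_of_formallySmooth (k R : Type*) [Field k] [CommRing R]
    [IsLocalRing R] [IsAdicComplete (maximalIdeal R) R] [Algebra k R]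
    [Algebra.FormallySmooth k (ResidueField R)] :
    ∃ F : Subring R, IsField F ∧
      Function.Bijective (fun x : F => residue R (x : R)) := by
  obtain ⟨g, hg⟩ := Algebra.FormallySmooth.exists_mkₐ_comp_eq_of_isAdicComplete
    (R := k) (A := ResidueField R) (I := maximalIdeal R) (AlgHom.id k (ResidueField R))
  have hg (x) : residue R (g x) = x := congr($hg x)
  let e := RingEquiv.ofBijective g.toRingHom.rangeRestrict
    ⟨g.toRingHom.rangeRestrict.injective, g.toRingHom.rangeRestrict_surjective⟩
  refine ⟨g.toRingHom.range, e.symm.toMulEquiv.isField (Field.toIsField _), ?_, ?_⟩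
  · rintro ⟨_, x, rfl⟩ ⟨_, y, rfl⟩ h
    obtain rfl : x = y := by simpa [hg] using h
    rfl
  · exact fun x ↦ ⟨⟨g x, x, rfl⟩, hg x⟩

/-- **Cohen's theorem (coefficient fields).** Let `R` be a complete Noetherian local domain
containing a field, with maximal ideal `m`.  Then there exists a coefficient field, i.e. a
subfield `F ⊆ R` such that the composite `F → R → R/m` is an isomorphism of fields. -/
theorem exists_coefficient_field
    (R : Type*) [CommRing R] [IsDomain R] [IsNoetherianRing R] [IsLocalRing R]
    [IsAdicComplete (IsLocalRing.maximalIdeal R) R]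
    (hfield : ∃ F : Subring R, IsField F) :
    ∃ F : Subring R, IsField F ∧
      Function.Bijective (fun x : F => IsLocalRing.residue R (x : R)) := by
  obtain ⟨F, hF⟩ := hfield
  let : Field F := hF.toField
  obtain _ | ⟨p, _, _⟩ := CharP.exists' F
  · let : Algebra ℚ R := (F.subtype.comp (algebraMap ℚ F)).toAlgebra
    have := formallySmooth_of_charZero ℚ (IsLocalRing.ResidueField R)
    exact exists_coefficient_field_of_formallySmooth ℚ R
  · let : Algebra (ZMod p) R := (F.subtype.comp (ZMod.castHom dvd_rfl F)).toAlgebra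
    have := formallySmooth_zmod p (IsLocalRing.ResidueField R)
    exact exists_coefficient_field_of_formallySmooth (ZMod p) R
end

section
/- Let K be a complete discrete valuation field whose residue field κ has the same characteristic as K. Then K is isomorphic as a ring to the Laurent series field κ((t)). -/
open Algebra MvPolynomial in
/-- Every extension of a perfect field is formally smooth. -/
theorem Algebra.FormallySmooth.of_perfectField_of_field (k L : Type*) [Field k] [PerfectField k]
    [Field L] [Algebra k L] : Algebra.FormallySmooth k L := by
  refine ⟨inferInstance, ?_⟩
  rw [Extension.subsingleton_h1Cotangent, injective_iff_map_eq_zero]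
  intro x hx
  obtain ⟨⟨y, hy⟩, rfl⟩ := Extension.Cotangent.mk_surjective x
  change MvPolynomial L k at y
  rw [Extension.Cotangent.mk_eq_zero_iff]
  rw [Extension.cotangentComplex_mk] at hx
  obtain ⟨F, hF, hyF⟩ : ∃ F : IntermediateField k L,
      Algebra.EssFiniteType k F ∧ (y.vars : Set L) ⊆ F :=
    ⟨IntermediateField.adjoin k (y.vars : Set L),
      IntermediateField.essFiniteType_iff.mpr (IntermediateField.fg_adjoin_finset _),
      IntermediateField.subset_adjoin k _⟩
  obtain ⟨z, rfl⟩ := exists_rename_eq_of_vars_subset_range y (Subtype.val : F → L)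
    Subtype.val_injective (Subtype.range_coe.symm ▸ hyF)
  have hval (p : MvPolynomial F k) : algebraMap F L (aeval (_root_.id : F → F) p) =
      aeval (_root_.id : L → L) (rename (Subtype.val : F → L) p) := by
    rw [aeval_rename, ← aeval_algebraMap_apply]
    rfl
  have mem_ker (E : Type _) [Field E] [Algebra k E] (p : MvPolynomial E k) :
      p ∈ (Generators.self k E).ker ↔ aeval (_root_.id : E → E) p = 0 := by
    rw [Generators.ker_eq_ker_aeval_val]
    rfl
  have hz : z ∈ (Generators.self k F).ker := by
    refine (mem_ker F z).mpr ?_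
    replace hy := (mem_ker L _).mp hy
    apply (algebraMap F L).injective
    rw [map_zero]
    exact (hval z).trans hy
  have hz' : (Generators.self k F).toExtension.cotangentComplex
      (Extension.Cotangent.mk ⟨z, hz⟩) = 0 := by
    rw [Extension.cotangentComplex_mk]
    apply (Generators.self k F).cotangentSpaceBasis.repr.injective
    refine Finsupp.ext fun i ↦ ?_
    have := congr((Generators.self k L).cotangentSpaceBasis.repr $hx i)
    rw [Generators.cotangentSpaceBasis_repr_one_tmul] at this ⊢
    rw [pderiv_rename Subtype.val_injective] at this
    rw [map_zero, Finsupp.zero_apply] at this ⊢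
    apply (algebraMap F L).injective
    rw [map_zero]
    exact (hval _).trans this
  have hz2 := (Extension.subsingleton_h1Cotangent _).mp
    (FormallySmooth.subsingleton_h1Cotangent (R := k) (A := F)) (hz'.trans (map_zero _).symm)
  rw [Extension.Cotangent.mk_eq_zero_iff] at hz2
  have hle : Ideal.map (rename (Subtype.val : F → L)) (Generators.self k F).ker ≤
      (Generators.self k L).ker := by
    refine Ideal.map_le_iff_le_comap.mpr fun p hp ↦ (mem_ker L _).mpr ?_
    replace hp : aeval (_root_.id : F → F) p = 0 := (mem_ker F p).mp hp
    exact (hval p).symm.trans (by rw [hp, map_zero])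
  exact Ideal.pow_right_mono hle 2
    (Ideal.map_pow (rename (Subtype.val : F → L)) (Generators.self k F).ker 2 ▸
      Ideal.mem_map_of_mem (rename (Subtype.val : F → L)) hz2)

open PowerSeries in
/-- A domain complete along a nonzero principal ideal with a field of representatives for the
quotient is a power series ring. -/
theorem PowerSeries.nonempty_ringEquiv_of_isAdicComplete {k O : Type*} [Field k] [CommRing O]
    [IsDomain O] {π : O} (hπ : π ≠ 0) [IsAdicComplete (Ideal.span {π}) O] (s : k →+* O)
    (hs : Function.Surjective ((Ideal.Quotient.mk (Ideal.span {π})).comp s)) :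
    Nonempty (k⟦X⟧ ≃+* O) := by
  let : WithIdeal O := ⟨Ideal.span {π}⟩
  have hadic : IsAdic (Ideal.span {π}) := rfl
  obtain ⟨_, _⟩ := hadic.isAdicComplete_iff.mp ‹_›
  let : UniformSpace k := ⊥
  have : DiscreteTopology k := ⟨rfl⟩
  have : IsUniformAddGroup k := inferInstance
  have hev : HasEval π := by
    rw [hasEval_def, IsTopologicallyNilpotent, hadic.hasBasis_nhds_zero.tendsto_right_iff]
    intro n _
    filter_upwards [Filter.eventually_ge_atTop n] with m hm
    exact Ideal.pow_le_pow_right hm (Ideal.pow_mem_pow (Ideal.mem_span_singleton_self π) m)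
  let φ : k⟦X⟧ →+* O := eval₂Hom (φ := s) continuous_of_discreteTopology hev
  have hX : φ X = π := by simp [φ, coe_eval₂Hom]
  have hC (a : k) : φ (C a) = s a := by simp [φ, coe_eval₂Hom]
  have hmap : (Ideal.span {(X : k⟦X⟧)}).map φ = Ideal.span {π} := by
    rw [Ideal.map_span, Set.image_singleton, hX]
  refine ⟨.ofBijective φ ⟨?_, ?_⟩⟩
  · rw [injective_iff_map_eq_zero]
    intro f hf
    by_contra hf0
    obtain ⟨n, u, rfl⟩ := IsDiscreteValuationRing.eq_unit_mul_pow_irreducible hf0 X_irreducible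
    rw [map_mul, map_pow, hX] at hf
    exact mul_ne_zero (u.isUnit.map φ).ne_zero (pow_ne_zero n hπ) hf
  · have : IsHausdorff ((Ideal.span {(X : k⟦X⟧)}).map φ) O := by rw [hmap]; infer_instance
    refine surjective_of_mk_map_comp_surjective (I := Ideal.span {(X : k⟦X⟧)}) φ ?_
    rw [hmap]
    intro y
    obtain ⟨a, rfl⟩ := hs y
    exact ⟨C a, by simp [hC]⟩

theorem exists_perfectField_algebra_of_ringChar_eq (O : Type*) [CommRing O] [IsDomain O]
    [IsLocalRing O] (h : ringChar O = ringChar (IsLocalRing.ResidueField O)) :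
    ∃ (k : Type) (_ : Field k) (_ : PerfectField k), Nonempty (Algebra k O) := by
  obtain h0 | h0 := eq_or_ne (ringChar O) 0
  · have : CharZero (IsLocalRing.ResidueField O) :=
      (CharP.ringChar_zero_iff_CharZero _).mp (h ▸ h0)
    refine ⟨ℚ, inferInstance, inferInstance, (EqualCharZero.nonempty_algebraRat_iff O).mpr ?_⟩
    intro I hI
    let f : O ⧸ I →+* IsLocalRing.ResidueField O :=
      Ideal.Quotient.factor (IsLocalRing.le_maximalIdeal hI)
    exact f.charZero
  · have : Fact (ringChar O).Prime := ⟨(CharP.char_is_prime_or_zero O _).resolve_right h0⟩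
    exact ⟨ZMod (ringChar O), inferInstance, inferInstance, ⟨ZMod.algebra O _⟩⟩

theorem Valuation.span_singleton_eq_setOf_le {K Γ : Type*} [Field K]
    [LinearOrderedCommGroupWithZero Γ] (v : Valuation K Γ) (a : v.valuationSubring) :
    (Ideal.span {a} : Set v.valuationSubring) = {x : v.valuationSubring | v x ≤ v a} := by
  ext x
  simp only [SetLike.mem_coe, Ideal.mem_span_singleton, Set.mem_ofPred_eq]
  constructor
  · rintro ⟨c, rfl⟩
    simpa using mul_le_of_le_one_right' c.2
  · intro h
    by_cases ha : (a : K) = 0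
    · rw [ha, map_zero, le_zero_iff, map_eq_zero] at h
      have : x = 0 := Subtype.ext h
      simp [this]
    · refine ⟨⟨x / a, ?_⟩, Subtype.ext (mul_div_cancel₀ _ ha).symm⟩
      rw [Valuation.mem_valuationSubring_iff, map_div₀]
      exact div_le_one_of_le₀ h zero_le

section

variable {K : Type*} [Field K] [hv : Valued K (WithZero (Multiplicative ℤ))]

theorem Valued.isAdic_span_singleton {π : hv.v.valuationSubring} (hπ : π ≠ 0)
    (hπ1 : hv.v (π : K) < 1) : IsAdic (Ideal.span {π}) := by
  have : IsTopologicalRing hv.v.valuationSubring :=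
    inferInstanceAs (IsTopologicalRing hv.v.valuationSubring.toSubring)
  rw [isAdic_iff]
  simp_rw [Ideal.span_singleton_pow, Valuation.span_singleton_eq_setOf_le]
  have hπ' : (π : K) ≠ 0 := by simpa using hπ
  refine ⟨fun n ↦ ?_, fun s hs ↦ ?_⟩
  · have := (Valued.isOpen_closedBall K (r := hv.v.restrict ((π ^ n : hv.v.valuationSubring) : K))
      (by simp [hπ'])).preimage (continuous_subtype_val (p := (· ∈ hv.v.valuationSubring)))
    simpa only [Valuation.restrict_le_iff, Set.preimage_ofPred_eq] using this
  · obtain ⟨t, ht, hts⟩ := mem_nhds_subtype _ _ _ |>.mp hs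
    obtain ⟨γ, hγ⟩ := Valued.mem_nhds_zero.mp ht
    have hmem : {x : K | hv.v.restrict x < γ} ∈ nhds (0 : K) :=
      Valued.mem_nhds_zero.mpr ⟨γ, subset_rfl⟩
    obtain ⟨n, hn⟩ := ((Valued.tendsto_zero_pow_of_v_lt_one hπ1).eventually hmem).exists
    refine ⟨n, fun x hx ↦ hts (hγ ?_)⟩
    exact lt_of_le_of_lt (hv.v.restrict_le_iff.mpr hx) hn

theorem Valued.exists_isAdicComplete_span_singleton_eq_maximalIdeal [CompleteSpace K]
    (hsurj : Function.Surjective hv.v) :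
    ∃ π : hv.v.valuationSubring, π ≠ 0 ∧ IsLocalRing.maximalIdeal hv.v.valuationSubring = Ideal.span {π} ∧
      IsAdicComplete (Ideal.span {π}) hv.v.valuationSubring := by
  obtain ⟨a, ha⟩ := hsurj (WithZero.exp (-1))
  have ha1 : hv.v a < 1 := by
    rw [ha, ← WithZero.exp_zero, WithZero.exp_lt_exp]; norm_num
  let π : hv.v.valuationSubring := ⟨a, ha1.le⟩
  have hπ : π ≠ 0 := by
    intro h
    have : a = 0 := congrArg Subtype.val h
    rw [this, map_zero] at ha
    exact WithZero.exp_ne_zero ha.symm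
  refine ⟨π, hπ, ?_, ?_⟩
  · apply SetLike.coe_injective
    rw [Valuation.span_singleton_eq_setOf_le]
    ext x
    rw [SetLike.mem_coe, Valuation.mem_maximalIdeal_iff, Set.mem_ofPred_eq,
      show hv.v (π : K) = _ from ha]
    by_cases hx : hv.v (x : K) = 0
    · simp [hx]
    · rw [← WithZero.exp_log hx, ← WithZero.exp_zero, WithZero.exp_lt_exp, WithZero.exp_le_exp]
      lia
  · have : CompleteSpace hv.v.valuationSubring :=
      (Valued.isClosed_valuationSubring K).completeSpace_coe
    have : IsUniformAddGroup hv.v.valuationSubring :=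
      inferInstanceAs (IsUniformAddGroup hv.v.valuationSubring.toSubring.toAddSubgroup)
    exact (Valued.isAdic_span_singleton hπ ha1).isAdicComplete_iff.mpr
      ⟨inferInstance, inferInstance⟩

end

/-- A complete local domain of equal characteristic has a coefficient field. -/
theorem IsLocalRing.exists_ringHom_residueField_section {O : Type*} [CommRing O] [IsDomain O]
    [IsLocalRing O] [IsAdicComplete (maximalIdeal O) O]
    (h : ringChar O = ringChar (ResidueField O)) :
    ∃ s : ResidueField O →+* O, ∀ x, residue O (s x) = x := by
  obtain ⟨k, _, _, ⟨_⟩⟩ := exists_perfectField_algebra_of_ringChar_eq O h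
  have := Algebra.FormallySmooth.of_perfectField_of_field k (ResidueField O)
  obtain ⟨g, hg⟩ := Algebra.FormallySmooth.exists_mkₐ_comp_eq_of_isAdicComplete
    (I := maximalIdeal O) (AlgHom.id k (ResidueField O))
  exact ⟨g, fun x ↦ DFunLike.congr_fun hg x⟩

/-- Let `K` be a complete discrete valuation field whose residue field `κ` has the same
characteristic as `K`.  Then `K` is isomorphic as a ring to the Laurent series field
`κ((t))`. -/
theorem complete_discrete_valuation_field_iso_laurentSeries
    (K : Type*) [Field K] [hv : Valued K (WithZero (Multiplicative ℤ))]
    [CompleteSpace K]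
    (hv_surj : Function.Surjective hv.v)
    (hchar : ringChar K = ringChar (IsLocalRing.ResidueField hv.v.valuationSubring)) :
    Nonempty (K ≃+* LaurentSeries (IsLocalRing.ResidueField hv.v.valuationSubring)) := by
  obtain ⟨π, hπ, hm, hcomplete⟩ :=
    Valued.exists_isAdicComplete_span_singleton_eq_maximalIdeal hv_surj
  have : IsAdicComplete (IsLocalRing.maximalIdeal hv.v.valuationSubring) hv.v.valuationSubring :=
    hm ▸ hcomplete
  have hO : ringChar hv.v.valuationSubring = ringChar K := by
    have := charP_of_injective_ringHom (f := hv.v.valuationSubring.subtype)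
      Subtype.val_injective (ringChar hv.v.valuationSubring)
    exact (ringChar.eq K _).symm
  obtain ⟨s, hs⟩ := IsLocalRing.exists_ringHom_residueField_section (hO.trans hchar)
  have hsurj : Function.Surjective ((Ideal.Quotient.mk (Ideal.span {π})).comp s) := by
    rw [← hm]
    exact fun x ↦ ⟨x, hs x⟩
  obtain ⟨e⟩ := PowerSeries.nonempty_ringEquiv_of_isAdicComplete hπ s hsurj
  exact ⟨IsFractionRing.ringEquivOfRingEquiv e.symm⟩
end
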